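/- Let d ≥ 3, let V be in the reverse Hölder class RH_q for some q > d/2, let ρ be the associated critical radius function, let 1 < p < ∞, θ > 0, α ∈ [0,1), and let w ∈ A_p^{ρ,θ}(ℝ^d). There exists C > 0 such that for every f ∈ BMO^α_{L,w}(ℝ^d), every x₀ ∈ ℝ^d, and every r₀ with 0 < r₀ < ρ(x₀), one has |f_{B(x₀,r₀)}| ≤ C (ρ(x₀)/r₀)^{d(p+α−1)+pθ} |B(x₀,r₀)|^{α−1} w(B(x₀,r₀)) ‖f‖_{BMO^α_{L,w}}. -/

import Mathlib

open MeasureTheory Metric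

noncomputable section

/-- Euclidean space `ℝ^d`. -/
abbrev Rd (d : ℕ) := EuclideanSpace ℝ (Fin d)

/-- The Lebesgue measure `|B(x,r)|` of a ball, as a real number. -/
noncomputable def ballVol (d : ℕ) (x : Rd d) (r : ℝ) : ℝ :=
  (volume (ball x r)).toReal

/-- The integral `∫_{B(x,r)} g`. -/
noncomputable def ballInt (d : ℕ) (x : Rd d) (r : ℝ) (g : Rd d → ℝ) : ℝ :=
  ∫ y in ball x r, g y

/-- The average `|B(x,r)|⁻¹ ∫_{B(x,r)} g`. -/
noncomputable def ballAvg (d : ℕ) (x : Rd d) (r : ℝ) (g : Rd d → ℝ) : ℝ :=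
  (ballVol d x r)⁻¹ * ballInt d x r g

/-- `V` is a nonnegative, locally integrable, not a.e. zero function in the
reverse Hölder class `RH_q(ℝ^d)`. -/
def IsRH (d : ℕ) (q : ℝ) (V : Rd d → ℝ) : Prop :=
  (∀ x, 0 ≤ V x) ∧ LocallyIntegrable V volume ∧
  ¬ (∀ᵐ x ∂(volume : Measure (Rd d)), V x = 0) ∧
  ∃ C > 0, ∀ x r, 0 < r →
    (ballAvg d x r (fun y => V y ^ q)) ^ (1/q) ≤ C * ballAvg d x r V

/-- The critical radius function `ρ(x) = sup{r > 0 : r^{2-d} ∫_{B(x,r)} V ≤ 1}`. -/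
noncomputable def criticalRadius (d : ℕ) (V : Rd d → ℝ) (x : Rd d) : ℝ :=
  sSup {r : ℝ | 0 < r ∧ r ^ (2 - (d : ℝ)) * ballInt d x r V ≤ 1}

/-- The weight `w` belongs to the class `A_p^{ρ,θ}(ℝ^d)`. -/
def MemAp (d : ℕ) (p θ : ℝ) (ρ : Rd d → ℝ) (w : Rd d → ℝ) : Prop :=
  (∀ x, 0 < w x) ∧ Measurable w ∧ LocallyIntegrable w volume ∧
  LocallyIntegrable (fun x => w x ^ (-(1/(p-1)))) volume ∧
  ∃ C > 0, ∀ x r, 0 < r →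
    (((1 + r / ρ x) ^ θ * ballVol d x r)⁻¹ * ballInt d x r w) *
      (((1 + r / ρ x) ^ θ * ballVol d x r)⁻¹ *
        ballInt d x r (fun y => w y ^ (-(1/(p-1))))) ^ (p-1) ≤ C

/-- `C` is an admissible constant in the definition of `BMO^α_{L,w}` for `f`. -/
def BMOBound (d : ℕ) (α : ℝ) (ρ w f : Rd d → ℝ) (C : ℝ) : Prop :=
  (∀ x₀ r₀, 0 < r₀ → r₀ < ρ x₀ →
    ballInt d x₀ r₀ (fun y => |f y - ballAvg d x₀ r₀ f|) ≤
      C * (ballVol d x₀ r₀ ^ α * ballInt d x₀ r₀ w)) ∧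
  (∀ x₀ r₀, ρ x₀ ≤ r₀ →
    ballInt d x₀ r₀ (fun y => |f y|) ≤
      C * (ballVol d x₀ r₀ ^ α * ballInt d x₀ r₀ w))

/-- `f` belongs to the space `BMO^α_{L,w}(ℝ^d)`. -/
def MemBMO (d : ℕ) (α : ℝ) (ρ w f : Rd d → ℝ) : Prop :=
  LocallyIntegrable f volume ∧ ∃ C > 0, BMOBound d α ρ w f C

/-- The norm `‖f‖_{BMO^α_{L,w}}`: the least admissible constant. -/
noncomputable def bmoNorm (d : ℕ) (α : ℝ) (ρ w f : Rd d → ℝ) : ℝ :=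
  sInf {C : ℝ | 0 < C ∧ BMOBound d α ρ w f C}

theorem ballVol_pos {d : ℕ} (x : Rd d) {r : ℝ} (hr : 0 < r) : 0 < ballVol d x r :=
  ENNReal.toReal_pos (measure_ball_pos volume x hr).ne' measure_ball_lt_top.ne

theorem ballVol_eq_mul {d : ℕ} (x : Rd d) {r s : ℝ} (hr : 0 < r) (hs : 0 < s) :
    ballVol d x s = (s / r) ^ (d : ℝ) * ballVol d x r := by
  have h : ∀ t : ℝ, 0 < t → ballVol d x t = t ^ d * ballVol d 0 1 := fun t ht => by
    simp only [ballVol]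
    rw [Measure.addHaar_ball_of_pos volume x ht, ENNReal.toReal_mul,
      ENNReal.toReal_ofReal (by positivity), finrank_euclideanSpace_fin]
  rw [h s hs, h r hr, Real.rpow_natCast, div_pow]
  field_simp

theorem MeasureTheory.LocallyIntegrable.integrableOn_ball {d : ℕ} {g : Rd d → ℝ}
    (hg : LocallyIntegrable g volume) (x : Rd d) (r : ℝ) : IntegrableOn g (ball x r) :=
  (hg.integrableOn_isCompact (isCompact_closedBall x r)).mono_set ball_subset_closedBall

theorem ballInt_mono_radius {d : ℕ} {g : Rd d → ℝ} (hg : LocallyIntegrable g volume)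
    (h0 : ∀ y, 0 ≤ g y) (x : Rd d) {r s : ℝ} (hrs : r ≤ s) :
    ballInt d x r g ≤ ballInt d x s g :=
  setIntegral_mono_set (hg.integrableOn_ball x s) (ae_of_all _ h0)
    (ball_subset_ball hrs).eventuallyLE

theorem ballInt_pos {d : ℕ} {g : Rd d → ℝ} (hg : LocallyIntegrable g volume)
    (h0 : ∀ y, 0 < g y) (x : Rd d) {r : ℝ} (hr : 0 < r) : 0 < ballInt d x r g := by
  unfold ballInt
  rw [setIntegral_pos_iff_support_of_nonneg_ae (ae_of_all _ fun y => (h0 y).le)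
    (hg.integrableOn_ball x r)]
  have : Function.support g = Set.univ := by
    ext y
    simp [(h0 y).ne']
  rw [this, Set.univ_inter]
  exact measure_ball_pos volume x hr

theorem abs_ballAvg_sub_le {d : ℕ} {f : Rd d → ℝ} (hf : LocallyIntegrable f volume)
    (x : Rd d) {r s : ℝ} (hr : 0 < r) (hrs : r ≤ s) (c : ℝ) :
    |ballAvg d x r f - c| ≤ (ballVol d x r)⁻¹ * ballInt d x s (fun y => |f y - c|) := by
  have hb := ballVol_pos x hr
  have hc : LocallyIntegrable (fun y => f y - c) (volume : Measure (Rd d)) :=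
    hf.sub (locallyIntegrable_const c)
  have hconst : ballInt d x r (fun _ => c) = ballVol d x r * c := by
    simp [ballInt, ballVol, Measure.real]
  have hsub : ballInt d x r (fun y => f y - c) = ballInt d x r f - ballVol d x r * c := by
    rw [← hconst]
    exact integral_sub (hf.integrableOn_ball x r)
      ((locallyIntegrable_const c).integrableOn_ball x r)
  have heq : ballAvg d x r f - c = (ballVol d x r)⁻¹ * ballInt d x r (fun y => f y - c) := by
    rw [hsub, ballAvg]
    field_simp
  rw [heq, abs_mul, abs_of_pos (inv_pos.2 hb)]
  gcongr
  refine le_trans (abs_integral_le_integral_abs) ?_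
  exact ballInt_mono_radius (fun z => (hc z).norm) (fun y => abs_nonneg _) x hrs

/-- Hölder's inequality for a weight and its dual weight. -/
theorem ballVol_rpow_le_mul {d : ℕ} {p : ℝ} (hp : 1 < p) {w : Rd d → ℝ} (h0 : ∀ y, 0 < w y)
    (hw : LocallyIntegrable w volume)
    (hσ : LocallyIntegrable (fun y => w y ^ (-(1 / (p - 1)))) volume)
    (x : Rd d) {r : ℝ} (hr : 0 < r) :
    ballVol d x r ^ p ≤
      ballInt d x r w * ballInt d x r (fun y => w y ^ (-(1 / (p - 1)))) ^ (p - 1) := by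
  have hp1 : 0 < p - 1 := by linarith
  set b := ballVol d x r
  set W := ballInt d x r w
  set S := ballInt d x r (fun y => w y ^ (-(1 / (p - 1))))
  have hb : 0 < b := ballVol_pos x hr
  have hW : 0 < W := ballInt_pos hw h0 x hr
  have hS : 0 < S := ballInt_pos hσ (fun y => Real.rpow_pos_of_pos (h0 y) _) x hr
  set t := b / W
  have ht : 0 < t := div_pos hb hW
  have young : ∀ y, (1 : ℝ) ≤ t / p * w y +
      (p - 1) / p * t ^ (-(1 / (p - 1))) * w y ^ (-(1 / (p - 1))) := fun y => by
    have hu : 0 < t * w y := mul_pos ht (h0 y)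
    have h := Real.geom_mean_le_arith_mean2_weighted (w₁ := 1 / p) (w₂ := (p - 1) / p)
      (p₁ := t * w y) (p₂ := (t * w y) ^ (-(1 / (p - 1)))) (by positivity) (by positivity)
      hu.le (by positivity) (by field_simp; ring)
    rw [← Real.rpow_mul hu.le, ← Real.rpow_add hu,
      show 1 / p + -(1 / (p - 1)) * ((p - 1) / p) = 0 by field_simp; ring, Real.rpow_zero,
      Real.mul_rpow ht.le (h0 y).le] at h
    calc (1 : ℝ) ≤ _ := h
      _ = _ := by ring
  have key : b ≤ t / p * W + (p - 1) / p * t ^ (-(1 / (p - 1))) * S := by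
    have h1 : b = ballInt d x r (fun _ => (1 : ℝ)) := by
      simp [b, ballInt, ballVol, Measure.real]
    have hi1 := (hw.integrableOn_ball x r).const_mul (t / p)
    have hi2 := (hσ.integrableOn_ball x r).const_mul ((p - 1) / p * t ^ (-(1 / (p - 1))))
    rw [h1]
    simp only [W, S, ballInt]
    rw [← integral_const_mul, ← integral_const_mul, ← integral_add hi1 hi2]
    exact integral_mono ((locallyIntegrable_const (1 : ℝ)).integrableOn_ball x r)
      (hi1.add hi2) young
  have hbS : b ≤ t ^ (-(1 / (p - 1))) * S := by
    have htW : t * W = b := div_mul_cancel₀ _ hW.ne'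
    have h2 : t / p * W = b / p := by rw [div_mul_eq_mul_div, htW]
    rw [h2] at key
    have h3 : b * (p - 1) / p ≤ (p - 1) / p * (t ^ (-(1 / (p - 1))) * S) := by
      calc b * (p - 1) / p = b - b / p := by field_simp
        _ ≤ (p - 1) / p * t ^ (-(1 / (p - 1))) * S := by linarith
        _ = _ := by ring
    refine le_of_mul_le_mul_left (a := (p - 1) / p) ?_ (by positivity)
    calc (p - 1) / p * b = b * (p - 1) / p := by ring
      _ ≤ _ := h3
  have hpow := Real.rpow_le_rpow hb.le hbS hp1.le
  rw [Real.mul_rpow (by positivity) hS.le, ← Real.rpow_mul ht.le,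
    show -(1 / (p - 1)) * (p - 1) = -1 by field_simp, Real.rpow_neg_one] at hpow
  calc b ^ p = b * b ^ (p - 1) := by
        rw [show b ^ p = b ^ (1 + (p - 1)) by ring_nf, Real.rpow_add hb, Real.rpow_one]
    _ ≤ b * (t⁻¹ * S ^ (p - 1)) := by gcongr
    _ = W * S ^ (p - 1) := by simp only [t]; field_simp

/-- Comparison of the weighted measures of concentric balls up to twice the critical radius. -/
theorem MemAp.exists_ballInt_le {d : ℕ} {p θ : ℝ} {ρ w : Rd d → ℝ} (hw : MemAp d p θ ρ w)
    (hp : 1 < p) (hθ : 0 ≤ θ) (hρ : ∀ x, 0 < ρ x) :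
    ∃ C > 0, ∀ x r s, 0 < r → r ≤ s → s ≤ 2 * ρ x →
      ballInt d x s w ≤ C * (s / r) ^ ((d : ℝ) * p) * ballInt d x r w := by
  obtain ⟨h0, -, hwi, hσ, C, hC, hA⟩ := hw
  refine ⟨C * ((3 : ℝ) ^ θ) ^ p, by positivity, fun x r s hr hrs hsρ => ?_⟩
  have hs : 0 < s := hr.trans_le hrs
  have hσ0 : ∀ y, 0 < w y ^ (-(1 / (p - 1))) := fun y => Real.rpow_pos_of_pos (h0 y) _
  have holder := ballVol_rpow_le_mul hp h0 hwi hσ x hr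
  have hmono := ballInt_mono_radius hσ (fun y => (hσ0 y).le) x hrs
  have hb := ballVol_pos x hr
  have hv := ballVol_pos x hs
  have hWr := ballInt_pos hwi h0 x hr
  have hWs := ballInt_pos hwi h0 x hs
  have hSr := ballInt_pos hσ hσ0 x hr
  have hSs := ballInt_pos hσ hσ0 x hs
  have hAs := hA x s hs
  have hvb := ballVol_eq_mul x hr hs
  set b := ballVol d x r
  set v := ballVol d x s
  set Wr := ballInt d x r w
  set Ws := ballInt d x s w
  set Sr := ballInt d x r (fun y => w y ^ (-(1 / (p - 1))))
  set Ss := ballInt d x s (fun y => w y ^ (-(1 / (p - 1))))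
  have hq0 : 0 ≤ s / ρ x := div_nonneg hs.le (hρ x).le
  have hΨ0 : 0 < (1 + s / ρ x) ^ θ := by positivity
  have hΨ : (1 + s / ρ x) ^ θ ≤ 3 ^ θ := by
    have : s / ρ x ≤ 2 := (div_le_iff₀ (hρ x)).2 hsρ
    exact Real.rpow_le_rpow (by positivity) (by linarith) hθ
  set Ψ := (1 + s / ρ x) ^ θ
  have hΨv : 0 < Ψ * v := mul_pos hΨ0 hv
  have hprod : Ws * Ss ^ (p - 1) ≤ C * (Ψ * v) ^ p := by
    have hsplit : (Ψ * v) ^ p = (Ψ * v) * (Ψ * v) ^ (p - 1) := by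
      rw [show (Ψ * v) ^ p = (Ψ * v) ^ (1 + (p - 1)) by ring_nf, Real.rpow_add hΨv,
        Real.rpow_one]
    rw [Real.mul_rpow (by positivity) hSs.le, Real.inv_rpow hΨv.le] at hAs
    have hq : 0 < (Ψ * v) ^ (p - 1) := by positivity
    rw [hsplit]
    calc Ws * Ss ^ (p - 1)
        = ((Ψ * v)⁻¹ * Ws * (((Ψ * v) ^ (p - 1))⁻¹ * Ss ^ (p - 1))) *
            ((Ψ * v) * (Ψ * v) ^ (p - 1)) := by field_simp
      _ ≤ _ := by gcongr
  have hmain : Ws * b ^ p ≤ (C * (3 ^ θ) ^ p * (s / r) ^ ((d : ℝ) * p) * Wr) * b ^ p := by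
    calc Ws * b ^ p ≤ Ws * (Wr * Sr ^ (p - 1)) := by gcongr
      _ ≤ Ws * (Wr * Ss ^ (p - 1)) := by
          have : 0 ≤ p - 1 := by linarith
          gcongr
      _ = Wr * (Ws * Ss ^ (p - 1)) := by ring
      _ ≤ Wr * (C * (Ψ * v) ^ p) := by gcongr
      _ ≤ Wr * (C * (3 ^ θ * v) ^ p) := by gcongr
      _ = _ := by
          rw [hvb, Real.mul_rpow (by positivity) (by positivity),
            Real.mul_rpow (by positivity) hb.le, Real.rpow_mul (by positivity) (d : ℝ) p]
          ring
  exact le_of_mul_le_mul_right hmain (by positivity)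

/-- One doubling step for the averages of a function with a given `BMO` bound. -/
theorem BMOBound.abs_ballAvg_le {d : ℕ} {α : ℝ} {ρ w f : Rd d → ℝ} {N : ℝ}
    (hN : BMOBound d α ρ w f N) (hf : LocallyIntegrable f volume) (x : Rd d) {r : ℝ}
    (hr : 0 < r) :
    |ballAvg d x r f| ≤
      2 ^ (d : ℝ) * N * (ballVol d x (2 * r) ^ (α - 1) * ballInt d x (2 * r) w) +
        if 2 * r < ρ x then |ballAvg d x (2 * r) f| else 0 := by
  have h2r : 0 < 2 * r := by linarith
  have hle : r ≤ 2 * r := by linarith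
  have hb := ballVol_pos x hr
  have hv := ballVol_pos x h2r
  have hvol : (ballVol d x r)⁻¹ = 2 ^ (d : ℝ) * (ballVol d x (2 * r))⁻¹ := by
    rw [ballVol_eq_mul x hr h2r, mul_div_assoc, div_self hr.ne', mul_one]
    field_simp
  have hosc : ∀ c, ballInt d x (2 * r) (fun y => |f y - c|) ≤
      N * (ballVol d x (2 * r) ^ α * ballInt d x (2 * r) w) →
      |ballAvg d x r f - c| ≤
        2 ^ (d : ℝ) * N * (ballVol d x (2 * r) ^ (α - 1) * ballInt d x (2 * r) w) := by
    intro c hc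
    refine (abs_ballAvg_sub_le hf x hr hle c).trans ?_
    refine (mul_le_mul_of_nonneg_left hc (inv_pos.2 hb).le).trans_eq ?_
    rw [hvol, Real.rpow_sub hv, Real.rpow_one]
    field_simp
  split_ifs with h
  · have h1 := hosc _ (hN.1 x (2 * r) h2r h)
    have h2 := abs_add_le (ballAvg d x r f - ballAvg d x (2 * r) f) (ballAvg d x (2 * r) f)
    rw [sub_add_cancel] at h2
    linarith
  · have h1 := hosc 0 (by simpa using hN.2 x (2 * r) (not_lt.1 h))
    simpa using h1

/-- Iterating a doubling inequality whose increments grow like a positive power of the radius. -/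
theorem le_of_doubling {a g s ρ K : ℝ} {F : ℝ → ℝ} (ha : 0 < g) (hs : 0 < s) (hK : 0 ≤ K)
    (hsρ : s < ρ) (hkey : a = (1 - 2 ^ (-g))⁻¹)
    (hF : ∀ r, s ≤ r → r < ρ →
      F r ≤ K * (2 * r / s) ^ g + if 2 * r < ρ then F (2 * r) else 0) :
    F s ≤ a * K * (2 * ρ / s) ^ g := by
  have hlt : (2 : ℝ) ^ (-g) < 1 := Real.rpow_lt_one_of_one_lt_of_neg (by norm_num) (by linarith)
  have ha0 : 0 < a := hkey ▸ inv_pos.2 (by linarith)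
  have hρ : 0 < ρ := hs.trans hsρ
  have main : ∀ n : ℕ, ∀ r, s ≤ r → r < ρ → ρ ≤ 2 ^ n * r →
      F r ≤ a * K * ((2 * ρ / s) ^ g - (r / s) ^ g) := by
    intro n
    induction n with
    | zero =>
      intro r _ h1 h2
      rw [pow_zero, one_mul] at h2
      linarith
    | succ n ih =>
      intro r hsr hrρ hn
      have hr : 0 < r := hs.trans_le hsr
      have hstep := hF r hsr hrρ
      have htel : K * (2 * r / s) ^ g = a * K * ((2 * r / s) ^ g - (r / s) ^ g) := by
        have : (r / s) ^ g = 2 ^ (-g) * (2 * r / s) ^ g := by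
          rw [mul_div_assoc, Real.mul_rpow (by norm_num) (by positivity), ← mul_assoc,
            ← Real.rpow_add (by norm_num)]
          simp
        have h1 : a * (1 - 2 ^ (-g)) = 1 := by
          rw [hkey]
          exact inv_mul_cancel₀ (by linarith)
        rw [this]
        linear_combination (-(K * (2 * r / s) ^ g)) * h1
      rw [htel] at hstep
      split_ifs at hstep with h
      · have := ih (2 * r) (by linarith) h (by rw [pow_succ] at hn; linarith)
        linarith
      · have hmono : (2 * r / s) ^ g ≤ (2 * ρ / s) ^ g := by gcongr
        have : a * K * ((2 * r / s) ^ g - (r / s) ^ g) ≤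
            a * K * ((2 * ρ / s) ^ g - (r / s) ^ g) := by gcongr
        linarith
  obtain ⟨n, hn⟩ := pow_unbounded_of_one_lt (ρ / s) (one_lt_two : (1 : ℝ) < 2)
  refine (main n s le_rfl hsρ ((div_le_iff₀ hs).1 hn.le)).trans ?_
  have : 0 ≤ (s / s) ^ g := by positivity
  gcongr
  linarith

/-- Estimate for the average of `f ∈ BMO^α_{L,w}` over a sub-critical ball:
`|f_{B(x₀,r₀)}| ≤ C (ρ(x₀)/r₀)^{d(p+α-1)+pθ} |B(x₀,r₀)|^{α-1} w(B(x₀,r₀)) ‖f‖`. -/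
theorem statement18 (d : ℕ) (hd : 3 ≤ d) (q : ℝ) (hq : (d : ℝ) / 2 < q)
    (V : Rd d → ℝ) (hV : IsRH d q V)
    (ρ : Rd d → ℝ) (hρ : ρ = criticalRadius d V) (hρpos : ∀ x, 0 < ρ x)
    (p θ α : ℝ) (hp : 1 < p) (hθ : 0 < θ) (hα : 0 ≤ α) (hα1 : α < 1)
    (w : Rd d → ℝ) (hw : MemAp d p θ ρ w) :
    ∃ C > 0, ∀ f : Rd d → ℝ, MemBMO d α ρ w f →
      ∀ (x₀ : Rd d) (r₀ : ℝ), 0 < r₀ → r₀ < ρ x₀ →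
        |ballAvg d x₀ r₀ f| ≤
          C * (ρ x₀ / r₀) ^ ((d : ℝ) * (p + α - 1) + p * θ) *
            ballVol d x₀ r₀ ^ (α - 1) * ballInt d x₀ r₀ w * bmoNorm d α ρ w f := by
  have hd0 : (0 : ℝ) < d := by exact_mod_cast (by omega : 0 < d)
  obtain ⟨C, hC, hcomp⟩ := hw.exists_ballInt_le hp hθ.le hρpos
  obtain ⟨hw0, -, hwi, -⟩ := hw
  set g : ℝ := (d : ℝ) * (p + α - 1) with hg_def
  have hg : 0 < g := mul_pos hd0 (by linarith)
  have hlt : (2 : ℝ) ^ (-g) < 1 := Real.rpow_lt_one_of_one_lt_of_neg (by norm_num) (by linarith)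
  have ha0 : 0 < (1 - (2 : ℝ) ^ (-g))⁻¹ := inv_pos.2 (by linarith)
  set a : ℝ := (1 - (2 : ℝ) ^ (-g))⁻¹ with ha
  refine ⟨a * 2 ^ (d : ℝ) * C * 2 ^ g, by positivity, fun f hf x s hs hsρ => ?_⟩
  have hρx := hρpos x
  have hb := ballVol_pos x hs
  have hW := ballInt_pos hwi hw0 x hs
  have hbound : ∀ N, 0 < N → BMOBound d α ρ w f N → |ballAvg d x s f| ≤
      a * 2 ^ (d : ℝ) * C * 2 ^ g * (ρ x / s) ^ (g + p * θ) *
        ballVol d x s ^ (α - 1) * ballInt d x s w * N := by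
    intro N hN0 hN
    have hiter := le_of_doubling (a := a) (ρ := ρ x)
      (K := 2 ^ (d : ℝ) * N * C * (ballVol d x s ^ (α - 1) * ballInt d x s w))
      (F := fun r => |ballAvg d x r f|) hg hs (by positivity) hsρ ha ?_
    · refine hiter.trans ?_
      have hone : 1 ≤ ρ x / s := (one_le_div hs).2 hsρ.le
      have hpow : (ρ x / s) ^ g ≤ (ρ x / s) ^ (g + p * θ) :=
        Real.rpow_le_rpow_of_exponent_le hone (by nlinarith)
      rw [mul_div_assoc, Real.mul_rpow (by norm_num) (by positivity)]
      calc _ = a * 2 ^ (d : ℝ) * C * 2 ^ g * (ρ x / s) ^ g *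
            ballVol d x s ^ (α - 1) * ballInt d x s w * N := by ring
        _ ≤ _ := by gcongr
    · intro r hsr hrρ
      have hr : 0 < r := hs.trans_le hsr
      have hq : 0 < 2 * r / s := by positivity
      refine (hN.abs_ballAvg_le hf.1 x hr).trans ?_
      gcongr ?_ + _
      have hwle := hcomp x s (2 * r) hs (by linarith) (by linarith)
      have hexp : (2 * r / s) ^ g =
          ((2 * r / s) ^ (d : ℝ)) ^ (α - 1) * (2 * r / s) ^ ((d : ℝ) * p) := by
        rw [← Real.rpow_mul hq.le, ← Real.rpow_add hq, hg_def]
        ring_nf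
      rw [ballVol_eq_mul x hs (by positivity : 0 < 2 * r),
        Real.mul_rpow (by positivity) hb.le, hexp]
      calc _ ≤ 2 ^ (d : ℝ) * N * (((2 * r / s) ^ (d : ℝ)) ^ (α - 1) * ballVol d x s ^ (α - 1) *
            (C * (2 * r / s) ^ ((d : ℝ) * p) * ballInt d x s w)) := by gcongr
        _ = _ := by ring
  obtain ⟨N, hN⟩ := hf.2
  rw [← div_le_iff₀' (by positivity)]
  exact le_csInf ⟨N, hN⟩ fun M hM => (div_le_iff₀' (by positivity)).2 (hbound M hM.1 hM.2)
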